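/- Three-points Schwarz–Pick Lemma: let f be a slice regular self-map of 𝔹 which is not of the form ℳ_{p'} u with p' ∈ 𝔹 and |u| = 1, and let p, s ∈ 𝔹. Then for every q ∈ 𝔹, |(ℳ_{f⋆_p(s)} ∙ f⋆_p)(q)| ≤ |ℳ_s(q)|, where ℳ_s(q) evaluates as M_s(𝒯_s(q)) with M_s(q) = (1 − q s̄)⁻¹ (q − s) and 𝒯_s(q) = (1 − q s)⁻¹ q (1 − q s). -/

import Mathlib

noncomputable section

abbrev H : Type := Quaternion ℝ

namespace QPaper

/-- The complex slice determined by `I`: the real span of `1` and `I`. -/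
def sliceSet (I : H) : Set H := {q | ∃ x y : ℝ, q = (x : H) + y • I}

/-- Evaluation of the power series `q ↦ ∑ qᵐ aₘ` with right coefficients. -/
def evalC (a : ℕ → H) (q : H) : H := ∑' m, q ^ m * a m

/-- The series with coefficients `a` converges at every point of the unit ball. -/
def SummableOn (a : ℕ → H) : Prop := ∀ q : H, ‖q‖ < 1 → Summable fun m => q ^ m * a m

/-- `a` are the coefficients of a slice regular self-map of the unit ball. -/
def SelfMap (a : ℕ → H) : Prop :=
  SummableOn a ∧ ∀ q : H, ‖q‖ < 1 → ‖evalC a q‖ < 1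

/-- Coefficients of the ∗-product. -/
def starMulC (a b : ℕ → H) : ℕ → H := fun m => ∑ ℓ ∈ Finset.range (m + 1), a (m - ℓ) * b ℓ

/-- Coefficients of the ∗-inverse (of a series with invertible constant term). -/
def starInvC (a : ℕ → H) : ℕ → H
  | 0 => (a 0)⁻¹
  | m + 1 => -(a 0)⁻¹ * ∑ ℓ : Fin (m + 1), a (m + 1 - ℓ.val) * starInvC a ℓ.val
  decreasing_by exact ℓ.isLt

/-- Coefficients of `1 - q p̄`. -/
def oneMinusQPbarC (p : H) : ℕ → H := fun m => if m = 0 then 1 else if m = 1 then -(star p) else 0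

/-- Coefficients of `q - p`. -/
def qMinusPC (p : H) : ℕ → H := fun m => if m = 0 then -p else if m = 1 then 1 else 0

/-- Coefficients of the regular Möbius transformation `ℳ_p = (1 - q p̄)^{-∗} ∗ (q - p)`. -/
def mobiusC (p : H) : ℕ → H := starMulC (starInvC (oneMinusQPbarC p)) (qMinusPC p)

/-- Coefficients of `ℳ_{t₁} ∗ ⋯ ∗ ℳ_{t_κ}`. -/
def blaschkeListC : List H → (ℕ → H)
  | [] => fun m => if m = 0 then 1 else 0
  | t :: ts => starMulC (mobiusC t) (blaschkeListC ts)

/-- `a` are the coefficients of a regular Blaschke product of degree `κ`,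
i.e. of `ℳ_{t₁} ∗ ⋯ ∗ ℳ_{t_κ} u` with the `tᵢ` in `𝔹` and `u` unimodular. -/
def IsBlaschke (a : ℕ → H) (κ : ℕ) : Prop :=
  ∃ (ts : List H) (u : H), ts.length = κ ∧ (∀ t ∈ ts, ‖t‖ < 1) ∧ ‖u‖ = 1 ∧
    a = fun m => blaschkeListC ts m * u

/-- Coefficients of `ℳ_w ∙ f = (1 - f w̄)^{-∗} ∗ (f - w)`. -/
def bulletC (w : H) (a : ℕ → H) : ℕ → H :=
  starMulC (starInvC (fun m => (if m = 0 then (1 : H) else 0) - a m * star w))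
    (fun m => a m - if m = 0 then w else 0)

/-- Coefficients of the regular difference quotient `ℛ_{f,p}`,
the unique slice regular function with `f(q) = f(p) + (q - p) ∗ ℛ_{f,p}(q)`. -/
def diffQuotC (a : ℕ → H) (p : H) : ℕ → H := fun m => ∑' k, p ^ k * a (k + m + 1)

/-- Coefficients of the hyperbolic difference quotient
`f⋆_p = (1 - q p̄) ∗ ℛ_{f,p} ∗ (1 - \overline{f(p)} f)^{-∗} = ℳ_p^{-∗} ∗ (ℳ_{f(p)} ∙ f)`. -/
def hdqC (a : ℕ → H) (p : H) : ℕ → H :=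
  starMulC (starMulC (oneMinusQPbarC p) (diffQuotC a p))
    (starInvC (fun m => (if m = 0 then (1 : H) else 0) - star (evalC a p) * a m))

/-- Iterated hyperbolic difference quotients: `ihdqC a [p₁, …, pₙ] = ((f⋆_{p₁})⋆_{p₂} ⋯)⋆_{pₙ}`. -/
def ihdqC (a : ℕ → H) : List H → (ℕ → H)
  | [] => a
  | p :: ps => ihdqC (hdqC a p) ps

/-- `𝒯_p(q) = (1 - q p)⁻¹ q (1 - q p)`. -/
def mobiusT (p q : H) : H := (1 - q * p)⁻¹ * q * (1 - q * p)

/-- `M_p(q) = (1 - q p̄)⁻¹ (q - p)`. -/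
def mobiusM (p q : H) : H := (1 - q * star p)⁻¹ * (q - p)

/-- Pointwise evaluation of the regular Möbius transformation: `ℳ_p(q) = M_p(𝒯_p(q))`. -/
def mobiusEval (p q : H) : H := mobiusM p (mobiusT p q)

/-- The pseudo-hyperbolic distance `ρ(p,q) = |M_p(q)|`. -/
def rho (p q : H) : ℝ := ‖mobiusM p q‖

/-- The Poincaré distance `δ(p,q) = tanh⁻¹ ρ(p,q) = ½ log((1+ρ)/(1−ρ))`. -/
def pdist (p q : H) : ℝ := (1/2 : ℝ) * Real.log ((1 + rho p q) / (1 - rho p q))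



lemma nsq (x : H) : ‖x‖^2 = x.re^2 + x.imI^2 + x.imJ^2 + x.imK^2 := by
  rw [sq, ← Quaternion.normSq_eq_norm_mul_self x]
  exact Quaternion.normSq_def' x

lemma exI : ∃ i : H, i.re = 0 ∧ i.imI = 1 ∧ i.imJ = 0 ∧ i.imK = 0 :=
  ⟨⟨0,1,0,0⟩, rfl, rfl, rfl, rfl⟩

lemma pt_mobius (x y w : H) :
    ‖y - star w * x‖^2 = ‖x - w * y‖^2 + (1 - ‖w‖^2) * (‖y‖^2 - ‖x‖^2) := by
  simp only [nsq]; simp; ring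

lemma pt_id (b c d e : H) :
    ‖b*d - c*e‖^2 + ‖b*e + c*d‖^2 = (‖b‖^2+‖c‖^2)*(‖d‖^2+‖e‖^2)
      + 2 * (star c * b * (e * star d - d * star e)).re := by
  simp only [nsq]; simp; ring

lemma pt_op (b c d e : H) (M : ℝ) 
    (hM : ∀ J : H, J * J = -1 → ‖J‖ = 1 → ‖b + J * c‖ ≤ M) :
    ‖b*d - c*e‖^2 + ‖b*e + c*d‖^2 ≤ M^2 * (‖d‖^2+‖e‖^2) := by
  set u : H := (b * star c).im with hu
  have hre : u.re = 0 := by simp [hu]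
  have hM2 : ‖b‖^2+‖c‖^2 + 2 * ‖u‖ ≤ M^2 := by
    by_cases h0 : u = 0
    · obtain ⟨i, i0, i1, i2, i3⟩ := exI
      have h1 := hM i (by apply Quaternion.ext <;> simp [i0,i1,i2,i3] <;> rfl) (by
        have := nsq i
        simp [i0,i1,i2,i3] at this
        rcases this with h | h
        · exact h
        · have := norm_nonneg i; linarith)
      have h2 := pow_le_pow_left₀ (norm_nonneg _) h1 2
      rw [h0]
      have hi : (b * star c).imI = 0 := by
        have : u.imI = 0 := by rw [h0]; rfl
        rw [hu] at this; simpa using this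
      simp only [nsq] at h2
      rw [nsq, nsq, norm_zero]
      simp [i0,i1,i2,i3] at h2 hi ⊢
      nlinarith
    · have hn : ‖u‖ ≠ 0 := by simpa using h0
      have husq : u * u = -((‖u‖^2 : ℝ) : H) := by
        rw [nsq]; apply Quaternion.ext <;> simp only [Quaternion.re_mul, Quaternion.imI_mul, Quaternion.imJ_mul, Quaternion.imK_mul, hre, Quaternion.re_neg, Quaternion.imI_neg, Quaternion.imJ_neg, Quaternion.imK_neg, Quaternion.re_coe, Quaternion.imI_coe, Quaternion.imJ_coe, Quaternion.imK_coe] <;> ring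
      have h1 := hM (‖u‖⁻¹ • u) (by
        rw [smul_mul_smul_comm, husq]
        rw [smul_neg, ← Quaternion.coe_smul, smul_eq_mul]
        have : ‖u‖⁻¹ * ‖u‖⁻¹ * ‖u‖^2 = 1 := by field_simp
        rw [this]; simp) (by rw [norm_smul]; simp [hn])
      have h2 := pow_le_pow_left₀ (norm_nonneg _) h1 2
      have h3 : ‖b + ‖u‖⁻¹ • u * c‖^2 = ‖b‖^2 + ‖‖u‖⁻¹ • u‖^2 * ‖c‖^2 + 2 * ‖u‖⁻¹ * ‖u‖^2 := by
        generalize ‖u‖⁻¹ = t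
        simp only [nsq]; simp [hu]; ring
      rw [h3, norm_smul] at h2
      simp [hn] at h2
      have : 2 * ‖u‖⁻¹ * ‖u‖^2 = 2 * ‖u‖ := by field_simp
      linarith
  have h1 : (star c * b * (e * star d - d * star e)).re ≤ ‖u‖ * (‖d‖^2+‖e‖^2) := by
    have e1 : (star c * b * (e * star d - d * star e)).re 
       = ((star c * b).im * (e * star d - d * star e)).re := by
      have : (e * star d - d * star e).re = 0 := by simp; ring
      rw [Quaternion.re_mul, Quaternion.re_mul, this]; simp
    have e2 : ‖(star c * b).im‖ = ‖u‖ := by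
      rw [← sq_eq_sq₀ (norm_nonneg _) (norm_nonneg _), hu]
      simp only [nsq]; simp; ring
    have e3 : ‖e * star d - d * star e‖ ≤ ‖d‖^2+‖e‖^2 := by
      refine (norm_sub_le _ _).trans ?_
      simp only [norm_mul, norm_star]
      nlinarith [sq_nonneg (‖d‖-‖e‖)]
    have e4 : ∀ z : H, z.re ≤ ‖z‖ := fun z => by
      refine le_trans (le_abs_self _) (abs_le_of_sq_le_sq ?_ (norm_nonneg _))
      rw [nsq]; nlinarith [sq_nonneg z.imI, sq_nonneg z.imJ, sq_nonneg z.imK]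
    rw [e1]
    refine (e4 _).trans ?_
    rw [norm_mul, e2]
    gcongr
  rw [pt_id]
  nlinarith [sq_nonneg ‖d‖, sq_nonneg ‖e‖]


open PowerSeries in
/-- truncated square norm -/
def nr (N : ℕ) (K : PowerSeries H) : ℝ := ∑ n ∈ Finset.range N, ‖coeff n K‖^2

def Schur (F : PowerSeries H) : Prop := ∀ (K : PowerSeries H) (N : ℕ), nr N (F * K) ≤ nr N K

def cS (θ : ℝ) (P : Polynomial H) : H := P.sum fun n x => Real.cos (n * θ) • x
def sS (θ : ℝ) (P : Polynomial H) : H := P.sum fun n x => Real.sin (n * θ) • x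

lemma cS_add (θ : ℝ) (P Q : Polynomial H) : cS θ (P + Q) = cS θ P + cS θ Q := by
  unfold cS
  exact Polynomial.sum_add_index _ _ _ (by simp) (by intros; rw [smul_add])
lemma sS_add (θ : ℝ) (P Q : Polynomial H) : sS θ (P + Q) = sS θ P + sS θ Q := by
  unfold sS
  exact Polynomial.sum_add_index _ _ _ (by simp) (by intros; rw [smul_add])
lemma cS_mon (θ : ℝ) (n : ℕ) (x : H) : cS θ (Polynomial.monomial n x) = Real.cos (n * θ) • x := by
  unfold cS; exact Polynomial.sum_monomial_index _ _ (by simp)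
lemma sS_mon (θ : ℝ) (n : ℕ) (x : H) : sS θ (Polynomial.monomial n x) = Real.sin (n * θ) • x := by
  unfold sS; exact Polynomial.sum_monomial_index _ _ (by simp)

lemma cs_mul (θ : ℝ) (P Q : Polynomial H) :
    cS θ (P * Q) = cS θ P * cS θ Q - sS θ P * sS θ Q ∧
    sS θ (P * Q) = cS θ P * sS θ Q + sS θ P * cS θ Q := by
  induction P using Polynomial.induction_on' with
  | add P1 P2 h1 h2 =>
    rw [add_mul]; simp only [cS_add, sS_add, h1.1, h1.2, h2.1, h2.2]
    constructor <;> noncomm_ring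
  | monomial n x =>
    induction Q using Polynomial.induction_on' with
    | add Q1 Q2 h1 h2 =>
      rw [mul_add]; simp only [cS_add, sS_add, h1.1, h1.2, h2.1, h2.2]
      constructor <;> noncomm_ring
    | monomial m y =>
      rw [Polynomial.monomial_mul_monomial]
      simp only [cS_mon, sS_mon, smul_mul_smul_comm]
      push_cast
      rw [add_mul, Real.cos_add, Real.sin_add]
      constructor
      · module
      · module

lemma int_cos (n m : ℕ) : ∫ θ in (0:ℝ)..(2*Real.pi), Real.cos ((n - m : ℝ) * θ) =
    if n = m then 2 * Real.pi else 0 := by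
  split_ifs with h
  · subst h; simp
  · have : (n - m : ℝ) ≠ 0 := by
      rw [sub_ne_zero]; exact_mod_cast h
    rw [intervalIntegral.integral_comp_mul_left _ this]
    simp
    right
    have := Real.sin_int_mul_pi (2 * ((n:ℤ) - m))
    push_cast at this
    rw [← this]; congr 1; ring

open scoped InnerProductSpace in
lemma parseval (P : Polynomial H) :
    ∫ θ in (0:ℝ)..(2*Real.pi), (‖cS θ P‖^2 + ‖sS θ P‖^2) =
     2 * Real.pi * ∑ n ∈ P.support, ‖P.coeff n‖^2 := by
  have key : ∀ θ : ℝ, ‖cS θ P‖^2 + ‖sS θ P‖^2 =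
      ∑ n ∈ P.support, ∑ m ∈ P.support, Real.cos ((n - m : ℝ) * θ) * ⟪P.coeff n, P.coeff m⟫_ℝ := by
    intro θ
    rw [← real_inner_self_eq_norm_sq, ← real_inner_self_eq_norm_sq]
    simp only [cS, sS, Polynomial.sum, sum_inner, inner_sum, real_inner_smul_left, real_inner_smul_right]
    rw [← Finset.sum_add_distrib]
    refine Finset.sum_congr rfl fun n _ => ?_
    rw [← Finset.sum_add_distrib]
    refine Finset.sum_congr rfl fun m _ => ?_
    rw [sub_mul, Real.cos_sub, real_inner_comm (P.coeff n) (P.coeff m)]; ring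
  simp only [key]
  rw [intervalIntegral.integral_finsetSum]
  · rw [Finset.mul_sum]
    refine Finset.sum_congr rfl fun n hn => ?_
    rw [intervalIntegral.integral_finsetSum]
    · simp only [intervalIntegral.integral_mul_const, int_cos]
      simp only [ite_mul, zero_mul]
      rw [Finset.sum_ite_eq, if_pos hn, real_inner_self_eq_norm_sq]
    · intro m _
      apply Continuous.intervalIntegrable; fun_prop
  · intro m _
    apply Continuous.intervalIntegrable; fun_prop

lemma cont_cS (P : Polynomial H) : Continuous fun θ => cS θ P := by
  unfold cS Polynomial.sum; fun_prop
lemma cont_sS (P : Polynomial H) : Continuous fun θ => sS θ P := by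
  unfold sS Polynomial.sum; fun_prop

lemma poly_bound (P Q : Polynomial H) (M : ℝ)
    (hM : ∀ θ : ℝ, ∀ J : H, J * J = -1 → ‖J‖ = 1 → ‖cS θ P + J * sS θ P‖ ≤ M) :
    ∑ n ∈ (P*Q).support, ‖(P*Q).coeff n‖^2 ≤ M^2 * ∑ n ∈ Q.support, ‖Q.coeff n‖^2 := by
  have h1 := parseval (P*Q)
  have h2 := parseval Q
  have h3 : ∫ θ in (0:ℝ)..(2*Real.pi), (‖cS θ (P*Q)‖^2 + ‖sS θ (P*Q)‖^2) ≤
     ∫ θ in (0:ℝ)..(2*Real.pi), M^2 * (‖cS θ Q‖^2 + ‖sS θ Q‖^2) := by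
    apply intervalIntegral.integral_mono_on (by positivity)
    · apply Continuous.intervalIntegrable
      have := cont_cS (P*Q); have := cont_sS (P*Q); fun_prop
    · apply Continuous.intervalIntegrable
      have := cont_cS Q; have := cont_sS Q; fun_prop
    · intro θ _
      rw [(cs_mul θ P Q).1, (cs_mul θ P Q).2]
      exact pt_op _ _ _ _ M (hM θ)
  rw [h1, intervalIntegral.integral_const_mul, h2] at h3
  have := Real.pi_pos
  nlinarith

lemma pow_slice (J : H) (hJ : J * J = -1) (r θ : ℝ) (n : ℕ) :
    (r • ((Real.cos θ : ℝ) • (1:H) + Real.sin θ • J))^n = 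
      r^n • (Real.cos (n*θ) • (1:H) + Real.sin (n*θ) • J) := by
  rw [smul_pow]; congr 1
  induction n with
  | zero => simp
  | succ n ih =>
    rw [pow_succ, ih]
    push_cast
    rw [add_mul (n:ℝ), one_mul, Real.cos_add, Real.sin_add]
    simp only [mul_add, add_mul, smul_mul_smul_comm, hJ, one_mul, mul_one]
    module

lemma norm_slice (J : H) (hJ : J * J = -1) (hJ1 : ‖J‖ = 1) (θ : ℝ) :
    ‖((Real.cos θ : ℝ) • (1:H) + Real.sin θ • J)‖ = 1 := by
  have hre : J.re = 0 := by
    have a0 := congrArg (fun z : H => z.re) hJ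
    have h1 := nsq J
    rw [hJ1] at h1
    have e : (J*J).re = -1 := by rw [hJ]; rfl
    simp at e
    nlinarith
  have h1 := nsq J
  rw [hJ1, hre] at h1
  have : ‖((Real.cos θ : ℝ) • (1:H) + Real.sin θ • J)‖^2 = 1 := by
    rw [nsq]
    have o1 : (1:H).re = 1 := rfl
    have o2 : (1:H).imI = 0 := rfl
    have o3 : (1:H).imJ = 0 := rfl
    have o4 : (1:H).imK = 0 := rfl
    simp only [Quaternion.re_add, Quaternion.imI_add, Quaternion.imJ_add, Quaternion.imK_add,
      Quaternion.re_smul, Quaternion.imI_smul, Quaternion.imJ_smul, Quaternion.imK_smul, o1,o2,o3,o4,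
      hre, smul_eq_mul]
    have := Real.sin_sq_add_cos_sq θ
    linear_combination this - Real.sin θ^2 * h1
  have h0 := norm_nonneg ((Real.cos θ : ℝ) • (1:H) + Real.sin θ • J)
  nlinarith

lemma cS_sum (θ : ℝ) (M : ℕ) (g : ℕ → H) :
    cS θ (∑ m ∈ Finset.range M, Polynomial.monomial m (g m)) =
     ∑ m ∈ Finset.range M, Real.cos (m * θ) • g m := by
  induction M with
  | zero => simp [cS]
  | succ M ih => rw [Finset.sum_range_succ, cS_add, ih, cS_mon, Finset.sum_range_succ]

lemma sS_sum (θ : ℝ) (M : ℕ) (g : ℕ → H) :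
    sS θ (∑ m ∈ Finset.range M, Polynomial.monomial m (g m)) =
     ∑ m ∈ Finset.range M, Real.sin (m * θ) • g m := by
  induction M with
  | zero => simp [sS]
  | succ M ih => rw [Finset.sum_range_succ, sS_add, ih, sS_mon, Finset.sum_range_succ]

lemma coeff_tr (M : ℕ) (g : ℕ → H) (n : ℕ) :
    (∑ m ∈ Finset.range M, Polynomial.monomial m (g m)).coeff n = if n < M then g n else 0 := by
  rw [Polynomial.finsetSum_coeff]
  simp [Polynomial.coeff_monomial]

lemma sum_le_supp (P : Polynomial H) (N : ℕ) :
    ∑ n ∈ Finset.range N, ‖P.coeff n‖^2 ≤ ∑ n ∈ P.support, ‖P.coeff n‖^2 := by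
  rw [← Finset.sum_filter_add_sum_filter_not (Finset.range N) (fun n => n ∈ P.support)]
  have : ∑ x ∈ Finset.range N with ¬ x ∈ P.support, ‖P.coeff x‖^2 = 0 := by
    apply Finset.sum_eq_zero
    intro x hx
    simp at hx
    simp [hx.2]
  rw [this, add_zero]
  apply Finset.sum_le_sum_of_subset_of_nonneg
  · intro x hx; exact (Finset.mem_filter.1 hx).2
  · intros; positivity

lemma supp_le_sum (P : Polynomial H) (N : ℕ) (h : ∀ n, N ≤ n → P.coeff n = 0) :
    ∑ n ∈ P.support, ‖P.coeff n‖^2 ≤ ∑ n ∈ Finset.range N, ‖P.coeff n‖^2 := by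
  apply Finset.sum_le_sum_of_subset_of_nonneg
  · intro x hx
    rw [Polynomial.mem_support_iff] at hx
    rw [Finset.mem_range]
    by_contra hc
    exact hx (h x (not_lt.1 hc))
  · intros; positivity

open Filter Topology in
lemma dil_bound (a : ℕ → H) (hs : SummableOn a) (hb : ∀ q : H, ‖q‖ < 1 → ‖evalC a q‖ ≤ 1)
    (K : PowerSeries H) (N : ℕ) (r : ℝ) (hr0 : 0 ≤ r) (hr1 : r < 1) :
    ∑ n ∈ Finset.range N, (r^n * ‖PowerSeries.coeff n (PowerSeries.mk a * K)‖)^2 ≤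
    ∑ n ∈ Finset.range N, (r^n * ‖PowerSeries.coeff n K‖)^2 := by
  have hA : Summable fun m => r^m * ‖a m‖ := by
    have := (hs (r : H) (by simpa [abs_of_nonneg hr0] using hr1)).norm
    simpa [abs_of_nonneg hr0] using this
  set ε : ℕ → ℝ := fun M => ∑' k, r^(k+M) * ‖a (k+M)‖ with hε
  have hεl : Tendsto ε atTop (𝓝 0) := tendsto_sum_nat_add fun m => r^m * ‖a m‖
  have main : ∀ M, N ≤ M → 
    ∑ n ∈ Finset.range N, (r^n * ‖PowerSeries.coeff n (PowerSeries.mk a * K)‖)^2 ≤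
     (1 + ε M)^2 * ∑ n ∈ Finset.range N, (r^n * ‖PowerSeries.coeff n K‖)^2 := by
    intro M hM
    set P : Polynomial H := ∑ m ∈ Finset.range M, Polynomial.monomial m (r^m • a m) with hP
    set Q : Polynomial H := ∑ m ∈ Finset.range N, Polynomial.monomial m (r^m • PowerSeries.coeff m K) with hQ
    have h1 := poly_bound P Q (1 + ε M) (by
      intro θ J hJ hJ1
      set q : H := r • ((Real.cos θ : ℝ) • (1:H) + Real.sin θ • J) with hq
      have hqn : ‖q‖ = r := by rw [hq, norm_smul, norm_slice J hJ hJ1]; simp [abs_of_nonneg hr0]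
      have hq1 : ‖q‖ < 1 := by rw [hqn]; exact hr1
      have e1 : cS θ P + J * sS θ P = ∑ m ∈ Finset.range M, q^m * a m := by
        rw [hP, cS_sum, sS_sum, Finset.mul_sum, ← Finset.sum_add_distrib]
        refine Finset.sum_congr rfl fun m _ => ?_
        rw [hq, pow_slice J hJ]
        simp only [smul_mul_assoc, add_mul, one_mul, mul_smul_comm]
        module
      have e2 := (hs q hq1).sum_add_tsum_nat_add M
      have e3 : ∑ m ∈ Finset.range M, q^m * a m = evalC a q - ∑' k, q^(k+M) * a (k+M) := by
        rw [evalC, ← e2]; simp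
      rw [e1, e3]
      refine (norm_sub_le _ _).trans (add_le_add (hb q hq1) ?_)
      have hsn : Summable fun k => ‖q^(k+M) * a (k+M)‖ := by
        have := (summable_nat_add_iff M).2 hA
        simpa [hqn] using this
      refine (norm_tsum_le_tsum_norm hsn).trans (le_of_eq ?_)
      rw [hε]; simp [hqn])
    have h2 := sum_le_supp (P*Q) N
    have h3 := supp_le_sum Q N (by
      intro n hn; rw [hQ, coeff_tr, if_neg (not_lt.2 hn)])
    have h4 : ∑ n ∈ Finset.range N, ‖Q.coeff n‖^2 = 
        ∑ n ∈ Finset.range N, (r^n * ‖PowerSeries.coeff n K‖)^2 := by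
      refine Finset.sum_congr rfl fun n hn => ?_
      rw [hQ, coeff_tr, if_pos (Finset.mem_range.1 hn), norm_smul]
      simp [abs_of_nonneg hr0]
    have h5 : ∑ n ∈ Finset.range N, ‖(P*Q).coeff n‖^2 = 
        ∑ n ∈ Finset.range N, (r^n * ‖PowerSeries.coeff n (PowerSeries.mk a * K)‖)^2 := by
      refine Finset.sum_congr rfl fun n hn => ?_
      have hnN := Finset.mem_range.1 hn
      have : (P*Q).coeff n = r^n • PowerSeries.coeff n (PowerSeries.mk a * K) := by
        rw [Polynomial.coeff_mul, PowerSeries.coeff_mul, Finset.smul_sum]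
        refine Finset.sum_congr rfl fun x hx => ?_
        have hx' := Finset.HasAntidiagonal.mem_antidiagonal.1 hx
        rw [hP, hQ, coeff_tr, coeff_tr, if_pos (by omega), if_pos (by omega), smul_mul_smul_comm,
          ← pow_add, hx', PowerSeries.coeff_mk]
      rw [this, norm_smul]
      simp [abs_of_nonneg hr0]
    rw [h5] at h2; rw [h4] at h3
    refine h2.trans (h1.trans ?_)
    gcongr
  have hlim : Tendsto (fun M => (1 + ε M)^2 * ∑ n ∈ Finset.range N, (r^n * ‖PowerSeries.coeff n K‖)^2)
      atTop (𝓝 ((1+0)^2 * ∑ n ∈ Finset.range N, (r^n * ‖PowerSeries.coeff n K‖)^2)) :=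
    ((tendsto_const_nhds.add hεl).pow 2).mul tendsto_const_nhds
  simp only [add_zero, one_pow, one_mul] at hlim
  exact ge_of_tendsto hlim (eventually_atTop.2 ⟨N, main⟩)

open Filter Topology in
lemma bounded_schur (a : ℕ → H) (hs : SummableOn a) (hb : ∀ q : H, ‖q‖ < 1 → ‖evalC a q‖ ≤ 1) :
    Schur (PowerSeries.mk a) := by
  intro K N
  have c : ∀ L : PowerSeries H, Tendsto (fun r : ℝ => ∑ n ∈ Finset.range N, (r^n * ‖PowerSeries.coeff n L‖)^2)
      (𝓝[<] 1) (𝓝 (nr N L)) := by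
    intro L
    have : Continuous (fun r : ℝ => ∑ n ∈ Finset.range N, (r^n * ‖PowerSeries.coeff n L‖)^2) := by fun_prop
    have h := this.tendsto 1
    simp only [one_pow, one_mul] at h
    exact h.mono_left nhdsWithin_le_nhds
  refine le_of_tendsto_of_tendsto (c _) (c _) ?_
  have : Set.Ioo (0:ℝ) 1 ∈ 𝓝[<] (1:ℝ) := Ioo_mem_nhdsLT (by norm_num)
  filter_upwards [this] with r hr
  exact dil_bound a hs hb K N r hr.1.le hr.2

open PowerSeries

lemma coeff_mul_r (n : ℕ) (F G : PowerSeries H) :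
    coeff n (F * G) = ∑ k ∈ Finset.range (n+1), coeff (n-k) F * coeff k G := by
  rw [PowerSeries.coeff_mul, ← Finset.Nat.sum_antidiagonal_swap,
    Finset.Nat.sum_antidiagonal_eq_sum_range_succ_mk]
  rfl

lemma starMul_eq (a b : ℕ → H) : PowerSeries.mk (starMulC a b) = PowerSeries.mk a * PowerSeries.mk b := by
  ext n : 1
  rw [coeff_mul_r]; simp [starMulC]

lemma nr_mono {M N : ℕ} (h : M ≤ N) (K : PowerSeries H) : nr M K ≤ nr N K := by
  apply Finset.sum_le_sum_of_subset_of_nonneg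
  · simpa using h
  · intros; positivity

lemma coeff_le_nr (n N : ℕ) (h : n < N) (K : PowerSeries H) : ‖coeff n K‖^2 ≤ nr N K :=
  Finset.single_le_sum (f := fun n => ‖coeff n K‖^2) (fun _ _ => by positivity) (Finset.mem_range.2 h)

lemma nr_one (N : ℕ) : nr N 1 ≤ 1 := by
  unfold nr
  calc _ ≤ ∑ n ∈ Finset.range N, (if n = 0 then (1:ℝ) else 0) := by
        apply Finset.sum_le_sum
        intro i _
        rw [coeff_one]; split_ifs <;> simp
    _ ≤ 1 := by rw [Finset.sum_ite_eq']; split_ifs <;> norm_num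

lemma Schur.nr_le {F : PowerSeries H} (hF : Schur F) (N : ℕ) : nr N F ≤ 1 := by
  have := hF 1 N
  rw [mul_one] at this
  exact this.trans (nr_one N)

lemma Schur.coeff_le {F : PowerSeries H} (hF : Schur F) (n : ℕ) : ‖coeff n F‖ ≤ 1 := by
  have := (coeff_le_nr n (n+1) (Nat.lt_succ_self n) F).trans (hF.nr_le _)
  have h0 := norm_nonneg (coeff n F)
  nlinarith

lemma summable_of_bdd {b : ℕ → H} {C : ℝ} (hb : ∀ n, ‖b n‖ ≤ C) {q : H} (hq : ‖q‖ < 1) :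
    Summable fun m => q^m * b m := by
  apply Summable.of_norm_bounded (g := fun m => ‖q‖^m * C)
  · exact (summable_geometric_of_lt_one (norm_nonneg _) hq).mul_right C
  · intro m
    rw [norm_mul, norm_pow]
    gcongr
    exact hb m

lemma coe_sumH (s : Finset ℕ) (g : ℕ → ℝ) : ((∑ l ∈ s, g l : ℝ) : H) = ∑ l ∈ s, (g l : H) := by
  induction s using Finset.induction_on with
  | empty => simp
  | insert a s ha ih => rw [Finset.sum_insert ha, Finset.sum_insert ha, Quaternion.coe_add, ih]

open scoped InnerProductSpace in
lemma schur_fin {F : PowerSeries H} (hF : Schur F) (q : H) (N : ℕ) (v : ℕ → H)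
    (hv : ∀ j, v j = ∑ m ∈ Finset.range j, q^m * coeff m F) :
    ∑ n ∈ Finset.range N, ‖coeff n (F * PowerSeries.mk (fun l => star (q^l * v (N-l)))) - star (q^n)‖^2
      + ∑ l ∈ Finset.range N, ‖q^l * v (N-l)‖^2 ≤ ∑ n ∈ Finset.range N, ‖q^n‖^2 := by
  set k : PowerSeries H := PowerSeries.mk (fun l => star (q^l * v (N-l))) with hk
  have h1 := hF k N
  have h2 : nr N k = ∑ l ∈ Finset.range N, ‖q^l * v (N-l)‖^2 := by
    unfold nr
    refine Finset.sum_congr rfl fun l _ => ?_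
    rw [hk, coeff_mk, norm_star]
  have h3 : ∑ n ∈ Finset.range N, q^n * coeff n (F*k) = 
      ((∑ l ∈ Finset.range N, ‖q^l * v (N-l)‖^2 : ℝ) : H) := by
    have e : ∀ n ∈ Finset.range N, q^n * coeff n (F*k) = ∑ l ∈ Finset.range (n+1), 
        (fun l j => q^l * (q^j * coeff j F) * coeff l k) l (n-l) := by
      intro n _
      rw [coeff_mul_r, Finset.mul_sum]
      refine Finset.sum_congr rfl fun l hl => ?_
      have : q^n = q^l * q^(n-l) := by
        rw [← pow_add]; congr 1; have := Finset.mem_range.1 hl; omega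
      rw [this]; simp only [mul_assoc]
    refine (Finset.sum_congr rfl e).trans ((Finset.sum_range_diag_flip N (fun l j => q^l * (q^j * coeff j F) * coeff l k)).trans ?_)
    have hc : ((∑ l ∈ Finset.range N, ‖q^l * v (N-l)‖^2 : ℝ) : H) =
        ∑ l ∈ Finset.range N, ((‖q^l * v (N-l)‖^2 : ℝ) : H) := coe_sumH _ _
    rw [hc]
    refine Finset.sum_congr rfl fun l hl => ?_
    rw [← Finset.sum_mul, ← Finset.mul_sum, ← hv, hk, coeff_mk, Quaternion.self_mul_star,
      Quaternion.normSq_eq_norm_mul_self]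
    rw [sq]
  have h4 : ∑ n ∈ Finset.range N, ⟪coeff n (F*k), star (q^n)⟫_ℝ = nr N k := by
    have : ∑ n ∈ Finset.range N, ⟪coeff n (F*k), star (q^n)⟫_ℝ = 
      (∑ n ∈ Finset.range N, q^n * coeff n (F*k)).re := by
      have hre : ∀ s : Finset ℕ, ∀ g : ℕ → H, (∑ n ∈ s, g n).re = ∑ n ∈ s, (g n).re := by
        intro s g
        induction s using Finset.induction_on with
        | empty => rfl
        | insert a s ha ih => rw [Finset.sum_insert ha, Finset.sum_insert ha, Quaternion.re_add, ih]
      rw [hre]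
      refine Finset.sum_congr rfl fun n _ => ?_
      rw [Quaternion.inner_def, star_star, Quaternion.re_mul, Quaternion.re_mul]
      ring
    rw [this, h3, h2, Quaternion.re_coe]
  have h5 : ∑ n ∈ Finset.range N, ‖coeff n (F * k) - star (q^n)‖^2 =
      nr N (F*k) - 2 * nr N k + ∑ n ∈ Finset.range N, ‖q^n‖^2 := by
    rw [← h4, nr, Finset.mul_sum, ← Finset.sum_sub_distrib, ← Finset.sum_add_distrib]
    refine Finset.sum_congr rfl fun n _ => ?_
    rw [norm_sub_sq_real, norm_star]
  rw [h5, ← h2]; linarith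

open Filter Topology in
lemma schur_lim {F : PowerSeries H} (hF : Schur F) (q : H) (hq : ‖q‖ < 1) (L : ℕ) (v : H)
    (hv : v = evalC (fun n => coeff n F) q) :
    ∑ n ∈ Finset.range L, ‖coeff n (F * PowerSeries.mk (fun l => star (q^l * v))) - star (q^n)‖^2
      + ∑ l ∈ Finset.range L, ‖q^l * v‖^2 ≤ (1 - ‖q‖^2)⁻¹ := by
  set w : ℕ → H := fun j => ∑ m ∈ Finset.range j, q^m * coeff m F with hw
  have hwl : Tendsto w atTop (𝓝 v) := by
    have := (summable_of_bdd (b := fun n => coeff n F) hF.coeff_le hq).hasSum.tendsto_sum_nat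
    rw [hv]; exact this
  have hwl' : ∀ l, Tendsto (fun N => w (N - l)) atTop (𝓝 v) := fun l =>
    hwl.comp (tendsto_sub_atTop_nat l)
  have lim : Tendsto (fun N => 
     ∑ n ∈ Finset.range L, ‖coeff n (F * PowerSeries.mk (fun l => star (q^l * w (N-l)))) - star (q^n)‖^2
      + ∑ l ∈ Finset.range L, ‖q^l * w (N-l)‖^2) atTop (𝓝 (
      ∑ n ∈ Finset.range L, ‖coeff n (F * PowerSeries.mk (fun l => star (q^l * v))) - star (q^n)‖^2
      + ∑ l ∈ Finset.range L, ‖q^l * v‖^2)) := by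
    refine Tendsto.add (tendsto_finsetSum _ fun n _ => ?_) (tendsto_finsetSum _ fun n _ => ?_)
    · refine (Tendsto.norm (Tendsto.sub_const ?_ _)).pow 2
      simp only [coeff_mul_r, coeff_mk]
      refine tendsto_finsetSum _ fun l _ => ?_
      exact ((hwl' l).const_mul _).star.const_mul _
    · exact (((hwl' n).const_mul _).norm).pow 2
  refine le_of_tendsto lim ?_
  filter_upwards [eventually_ge_atTop L] with N hN
  have h := schur_fin hF q N w (fun j => rfl)
  have hsub : Finset.range L ⊆ Finset.range N := by simpa using hN
  have h1 : ∑ n ∈ Finset.range N, ‖q^n‖^2 ≤ (1 - ‖q‖^2)⁻¹ := by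
    have h2 : ‖q‖^2 < 1 := by have := norm_nonneg q; nlinarith
    rw [← tsum_geometric_of_lt_one (by positivity) h2]
    have : ∀ n, ‖q^n‖^2 = (‖q‖^2)^n := fun n => by rw [norm_pow, ← pow_mul, ← pow_mul, mul_comm]
    simp only [this]
    exact (summable_geometric_of_lt_one (by positivity) h2).sum_le_tsum _ (fun _ _ => by positivity)
  refine le_trans (add_le_add ?_ ?_) (h.trans h1)
  · exact Finset.sum_le_sum_of_subset_of_nonneg hsub (fun _ _ _ => by positivity)
  · exact Finset.sum_le_sum_of_subset_of_nonneg hsub (fun _ _ _ => by positivity)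

open Filter Topology in
lemma tends_geo (q v : H) (hq : ‖q‖ < 1) : 
    Tendsto (fun L => ∑ l ∈ Finset.range L, ‖q^l * v‖^2) atTop (𝓝 ((1 - ‖q‖^2)⁻¹ * ‖v‖^2)) := by
  have h2 : ‖q‖^2 < 1 := by have := norm_nonneg q; nlinarith
  have := ((hasSum_geometric_of_lt_one (by positivity) h2).mul_right (‖v‖^2)).tendsto_sum_nat
  refine this.congr fun L => Finset.sum_congr rfl fun l _ => ?_
  rw [norm_mul, norm_pow, mul_pow, ← pow_mul, ← pow_mul, mul_comm l 2]

lemma schur_eval {F : PowerSeries H} (hF : Schur F) (q : H) (hq : ‖q‖ < 1) :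
    ‖evalC (fun n => coeff n F) q‖ ≤ 1 := by
  have h2 : 0 < (1 - ‖q‖^2)⁻¹ := by have := norm_nonneg q; rw [inv_pos]; nlinarith
  have := le_of_tendsto' (tends_geo q (evalC (fun n => coeff n F) q) hq) (b := (1 - ‖q‖^2)⁻¹) (fun L => by
    have := schur_lim hF q hq L _ rfl
    refine le_trans (le_add_of_nonneg_left ?_) this
    exact Finset.sum_nonneg fun _ _ => by positivity)
  have h3 : ‖evalC (fun n => coeff n F) q‖^2 ≤ 1 := by
    by_contra hc
    push Not at hc
    nlinarith
  have := norm_nonneg (evalC (fun n => coeff n F) q)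
  nlinarith

lemma schur_const {F : PowerSeries H} (hF : Schur F) (q : H) (hq : ‖q‖ < 1) (w : H)
    (hw : w = evalC (fun n => coeff n F) q) (hw1 : ‖w‖ = 1) (n : ℕ) :
    coeff n F * star w = if n = 0 then 1 else 0 := by
  have key : ∀ n, coeff n (F * PowerSeries.mk (fun l => star (q^l * w))) = star (q^n) := by
    intro n
    set d := ‖coeff n (F * PowerSeries.mk (fun l => star (q^l * w))) - star (q^n)‖^2 with hd
    have := le_of_tendsto ((tends_geo q w hq).const_add d) (b := (1 - ‖q‖^2)⁻¹) (by
      filter_upwards [Filter.eventually_gt_atTop n] with L hL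
      have := schur_lim hF q hq L w hw
      refine le_trans (add_le_add ?_ le_rfl) this
      exact Finset.single_le_sum (f := fun n => ‖coeff n (F * PowerSeries.mk (fun l => star (q^l * w))) - star (q^n)‖^2)
        (fun _ _ => by positivity) (Finset.mem_range.2 hL))
    rw [hw1] at this
    have hd0 : d ≤ 0 := by linarith
    have : d = 0 := le_antisymm hd0 (by positivity)
    rw [hd] at this
    simpa [sub_eq_zero] using this
  cases n with
  | zero => have := key 0; simpa [coeff_mul_r] using this
  | succ n =>
    have h1 := key (n+1)
    have h0 := key n
    rw [coeff_mul_r] at h0 h1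
    rw [Finset.sum_range_succ'] at h1
    have e : ∑ k ∈ Finset.range (n+1), coeff (n+1-(k+1)) F * coeff (k+1) (PowerSeries.mk (fun l => star (q^l * w)))
        = star (q^n) * star q := by
      rw [← h0, Finset.sum_mul]
      refine Finset.sum_congr rfl fun k _ => ?_
      rw [coeff_mk, coeff_mk, Nat.add_sub_add_right, mul_assoc, pow_succ']
      simp only [star_mul, star_pow, mul_assoc]
    rw [e] at h1
    simp [pow_succ'] at h1
    simpa using h1

open PowerSeries

lemma conv_sq (x z t : ℝ) (h0 : 0 ≤ t) (h1 : t < 1) : (x + t * z)^2 ≤ x^2 / (1 - t) + t * z^2 := by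
  have h : 0 < 1 - t := by linarith
  have : x^2 / (1 - t) + t * z^2 - (x + t * z)^2 = t / (1-t) * (x - (1-t)*z)^2 := by
    field_simp; ring
  have h2 : 0 ≤ t / (1-t) * (x - (1-t)*z)^2 := by positivity
  linarith

lemma lemY (Y Z : PowerSeries H) (r C D : ℝ) (h0 : 0 ≤ r) (h1 : r < 1)
    (h : ∀ n, ‖coeff n Y‖ ≤ ‖coeff (n+1) Z‖ + r * ‖coeff (n+1) Y‖)
    (hC : ∀ n, ‖coeff n Y‖ ≤ C) (hD : ∀ N, nr N Z ≤ D) : ∃ E, ∀ N, nr N Y ≤ E := by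
  have h : 0 < 1 - r := by linarith
  refine ⟨(D / (1-r) + r * C^2) / (1-r), fun N => ?_⟩
  have e1 : nr N Y ≤ ∑ n ∈ Finset.range N, (‖coeff (n+1) Z‖^2 / (1-r) + r * ‖coeff (n+1) Y‖^2) := by
    apply Finset.sum_le_sum
    intro n _
    refine le_trans ?_ (conv_sq _ _ r h0 h1)
    gcongr
    apply_assumption
  rw [Finset.sum_add_distrib, ← Finset.sum_div, ← Finset.mul_sum] at e1
  have e2 : ∀ W : PowerSeries H, ∑ n ∈ Finset.range N, ‖coeff (n+1) W‖^2 ≤ nr (N+1) W := by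
    intro W
    unfold nr; rw [Finset.sum_range_succ']
    have := sq_nonneg ‖coeff 0 W‖
    linarith
  have e3 : nr (N+1) Y ≤ nr N Y + C^2 := by
    unfold nr; rw [Finset.sum_range_succ]
    have := pow_le_pow_left₀ (norm_nonneg _) (hC N) 2
    linarith
  have e4 : (∑ n ∈ Finset.range N, ‖coeff (n+1) Z‖^2) / (1-r) ≤ D / (1-r) := by
    gcongr; exact (e2 Z).trans (hD _)
  have e5 := mul_le_mul_of_nonneg_left ((e2 Y).trans e3) h0
  rw [le_div_iff₀ h]
  linarith

lemma bdd_mul (R k : PowerSeries H) (C D : ℝ) (hC : ∀ N, nr N R ≤ C) (hD : ∀ N, nr N k ≤ D) (n : ℕ) :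
    ‖coeff n (R * k)‖ ≤ C + D := by
  rw [coeff_mul_r]
  refine (norm_sum_le _ _).trans ?_
  have : ∑ l ∈ Finset.range (n+1), ‖coeff (n-l) R * coeff l k‖ ≤
      ∑ l ∈ Finset.range (n+1), (‖coeff (n-l) R‖^2 + ‖coeff l k‖^2) := by
    apply Finset.sum_le_sum
    intro l _
    rw [norm_mul]
    nlinarith [sq_nonneg (‖coeff (n-l) R‖ - ‖coeff l k‖), sq_nonneg (‖coeff (n-l) R‖), sq_nonneg ‖coeff l k‖]
  refine this.trans ?_
  rw [Finset.sum_add_distrib]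
  have e := Finset.sum_range_reflect (fun l => ‖coeff l R‖^2) (n+1)
  simp only [Nat.add_sub_cancel] at e
  rw [e]
  exact add_le_add (hC (n+1)) (hD (n+1))

lemma bullet_nr {F : PowerSeries H} (hF : Schur F) (w : H) (hw : ‖w‖ ≤ 1) (k : PowerSeries H) (N : ℕ) :
    nr N ((F - C w) * k) ≤ nr N ((1 - C (star w) * F) * k) := by
  have h1 := hF k N
  have : nr N ((1 - C (star w) * F) * k) = nr N ((F - C w) * k) + (1 - ‖w‖^2) * (nr N k - nr N (F*k)) := by
    unfold nr
    rw [← Finset.sum_sub_distrib, Finset.mul_sum, ← Finset.sum_add_distrib]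
    refine Finset.sum_congr rfl fun n _ => ?_
    rw [sub_mul, sub_mul, one_mul, mul_assoc, map_sub, map_sub, coeff_C_mul, coeff_C_mul]
    exact pt_mobius _ _ _
  rw [this]
  have : 0 ≤ 1 - ‖w‖^2 := by have := norm_nonneg w; nlinarith
  nlinarith

lemma inv_nr {F : PowerSeries H} (hF : Schur F) (w : H) (hw : ‖w‖ < 1) (k : PowerSeries H) (N : ℕ) :
    nr N k ≤ nr N ((1 - C (star w) * F) * k) / (1 - ‖w‖)^2 := by
  have h0 := norm_nonneg w
  have h : 0 < 1 - ‖w‖ := by linarith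
  have h1 := hF k N
  set h' := (1 - C (star w) * F) * k with hh
  have e1 : nr N k ≤ ∑ n ∈ Finset.range N, (‖coeff n h'‖^2 / (1-‖w‖) + ‖w‖ * ‖coeff n (F*k)‖^2) := by
    apply Finset.sum_le_sum
    intro n _
    refine le_trans ?_ (conv_sq _ _ ‖w‖ h0 hw)
    gcongr
    have : coeff n k = coeff n h' + star w * coeff n (F*k) := by
      rw [hh, sub_mul, one_mul, mul_assoc, map_sub, coeff_C_mul]; simp
    rw [this]
    refine (norm_add_le _ _).trans ?_
    rw [norm_mul, norm_star]
  rw [Finset.sum_add_distrib, ← Finset.sum_div, ← Finset.mul_sum] at e1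
  change nr N k ≤ nr N h' / (1 - ‖w‖) + ‖w‖ * nr N (F*k) at e1
  have e2 := mul_le_mul_of_nonneg_left h1 h0
  rw [le_div_iff₀ (by positivity)]
  have e3 : nr N k * (1-‖w‖) ≤ nr N h' / (1 - ‖w‖) := by linarith
  rw [le_div_iff₀ h] at e3
  linarith

lemma p_nr (p : H) (Y : PowerSeries H) (N : ℕ) :
    nr (N+1) ((1 - X * C (star p)) * Y) = nr (N+1) ((X - C p) * Y) + (1-‖p‖^2) * ‖coeff N Y‖^2 := by
  have c0 : ∀ n, coeff (n+1) ((1 - X * C (star p)) * Y) = coeff (n+1) Y - star p * coeff n Y := by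
    intro n; rw [sub_mul, one_mul, mul_assoc, map_sub, coeff_succ_X_mul, coeff_C_mul]
  have c1 : ∀ n, coeff (n+1) ((X - C p) * Y) = coeff n Y - p * coeff (n+1) Y := by
    intro n; rw [sub_mul, map_sub, coeff_succ_X_mul, coeff_C_mul]
  induction N with
  | zero =>
    unfold nr
    simp only [zero_add, Finset.sum_range_one]
    rw [sub_mul, sub_mul, one_mul, mul_assoc, map_sub, map_sub, coeff_C_mul, coeff_zero_X_mul, coeff_zero_X_mul]
    simp only [sub_zero, zero_sub, norm_neg, norm_mul]; ring
  | succ N ih =>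
    unfold nr at ih ⊢
    rw [Finset.sum_range_succ, ih, Finset.sum_range_succ _ (N+1), c0, c1, pt_mobius]
    ring

open Filter Topology in
lemma hdq_schur {F R V : PowerSeries H} (hF : Schur F) (p w : H) (hp : ‖p‖ < 1) (hw : ‖w‖ < 1)
    (hR : (X - C p) * R = F - C w) (B : ℝ) (hB : ∀ n, ‖coeff n R‖ ≤ B)
    (hV : (1 - C (star w) * F) * V = 1) : Schur ((1 - X * C (star p)) * R * V) := by
  have hstep : ∀ Y Z : PowerSeries H, (X - C p) * Y = Z → 
      ∀ n, ‖coeff n Y‖ ≤ ‖coeff (n+1) Z‖ + ‖p‖ * ‖coeff (n+1) Y‖ := by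
    rintro Y Z rfl n
    have : coeff n Y = coeff (n+1) ((X - C p) * Y) + p * coeff (n+1) Y := by
      rw [sub_mul, map_sub, coeff_succ_X_mul, coeff_C_mul]; simp
    rw [this]
    refine (norm_add_le _ _).trans ?_
    rw [norm_mul]
  obtain ⟨ER, hER⟩ := lemY R (F - C w) ‖p‖ B 4 (norm_nonneg _) hp (hstep _ _ hR) hB (by
    intro M
    have e1 : nr M (F - C w) ≤ 2 * nr M F + 2 * nr M 1 := by
      unfold nr
      rw [Finset.mul_sum, Finset.mul_sum, ← Finset.sum_add_distrib]
      apply Finset.sum_le_sum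
      intro n _
      have e2 : coeff n (C w : PowerSeries H) = w * coeff n 1 := by rw [← coeff_C_mul, mul_one]
      rw [map_sub, e2]
      have e3 := norm_sub_le (coeff n F) (w * coeff n 1)
      have e4 : ‖w * coeff n (1 : PowerSeries H)‖ ≤ ‖coeff n (1 : PowerSeries H)‖ := by
        rw [norm_mul]; exact mul_le_of_le_one_left (norm_nonneg _) hw.le
      have e5 := pow_le_pow_left₀ (norm_nonneg _) (e3.trans (add_le_add le_rfl e4)) 2
      refine e5.trans ?_
      nlinarith [sq_nonneg (‖coeff n F‖ - ‖coeff n (1 : PowerSeries H)‖)]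
    have := hF.nr_le M
    have := nr_one M
    linarith)
  intro h N
  set h' : PowerSeries H := PowerSeries.mk fun n => if n < N then coeff n h else 0 with hh'
  have hh'le : ∀ M, nr M h' ≤ nr N h := by
    intro M
    calc nr M h' ≤ nr (max M N) h' := nr_mono (le_max_left _ _) _
      _ = nr N h' := by
        unfold nr
        symm
        apply Finset.sum_subset
        · simp
        · intro x _ hx
          simp at hx
          simp [hh', not_lt.2 hx]
      _ = nr N h := by
        unfold nr
        refine Finset.sum_congr rfl fun n hn => ?_
        simp [hh', Finset.mem_range.1 hn]
  have heq : nr N ((1 - X * C (star p)) * R * V * h) = nr N ((1 - X * C (star p)) * R * V * h') := by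
    unfold nr
    refine Finset.sum_congr rfl fun n hn => ?_
    have := Finset.mem_range.1 hn
    rw [coeff_mul_r, coeff_mul_r]
    congr 2
    refine Finset.sum_congr rfl fun l hl => ?_
    have := Finset.mem_range.1 hl
    rw [hh', coeff_mk, if_pos (by omega)]
  rw [heq]
  set k := V * h' with hk
  have hk1 : (1 - C (star w) * F) * k = h' := by rw [hk, ← mul_assoc, hV, one_mul]
  set Y := R * k with hY
  have hZ : (X - C p) * Y = (F - C w) * k := by rw [hY, ← mul_assoc, hR]
  have hZn : ∀ M, nr M ((F - C w) * k) ≤ nr N h := fun M => by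
    refine (bullet_nr hF w hw.le k M).trans ?_
    rw [hk1]; exact hh'le M
  have hkn : ∀ M, nr M k ≤ nr N h / (1-‖w‖)^2 := fun M => by
    refine (inv_nr hF w hw k M).trans ?_
    rw [hk1]; gcongr; exact hh'le M
  obtain ⟨EY, hEY⟩ := lemY Y _ ‖p‖ _ _ (norm_nonneg _) hp (hstep _ _ hZ) (bdd_mul R k _ _ hER hkn) hZn
  have hlim : Tendsto (fun n => ‖coeff n Y‖^2) atTop (𝓝 0) :=
    (summable_of_sum_range_le (fun _ => by positivity) hEY).tendsto_atTop_zero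
  have hlim2 : Tendsto (fun n => nr N h + (1-‖p‖^2) * ‖coeff n Y‖^2) atTop (𝓝 (nr N h + (1-‖p‖^2) * 0)) :=
    (hlim.const_mul _).const_add _
  rw [mul_zero, add_zero] at hlim2
  refine ge_of_tendsto hlim2 ?_
  filter_upwards [eventually_ge_atTop N] with M hM
  calc nr N ((1 - X * C (star p)) * R * V * h') ≤ nr (M+1) ((1 - X * C (star p)) * R * V * h') :=
        nr_mono (by omega) _
    _ = nr (M+1) ((1 - X * C (star p)) * Y) := by rw [hY, hk]; simp only [mul_assoc]
    _ ≤ _ := by rw [p_nr, hZ]; gcongr; exact hZn _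

open PowerSeries

lemma starInv_right (a : ℕ → H) (h : a 0 ≠ 0) :
    PowerSeries.mk a * PowerSeries.mk (starInvC a) = 1 := by
  ext n : 1
  rw [coeff_mul_r, coeff_one]
  cases n with
  | zero => simp [starInvC, h]
  | succ n =>
    rw [Finset.sum_range_succ]
    simp only [coeff_mk, Nat.sub_self]
    have : starInvC a (n+1) = -(a 0)⁻¹ * ∑ l ∈ Finset.range (n+1), a (n+1-l) * starInvC a l := by
      rw [starInvC, Finset.sum_range]
    rw [this, ← mul_assoc, mul_neg, mul_inv_cancel₀ h]
    simp

lemma starInv_left (a : ℕ → H) (h : a 0 ≠ 0) :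
    PowerSeries.mk (starInvC a) * PowerSeries.mk a = 1 := by
  have h1 := starInv_right a h
  have h2 := starInv_right (starInvC a) (by rw [starInvC]; exact inv_ne_zero h)
  have : PowerSeries.mk a = PowerSeries.mk (starInvC (starInvC a)) := by
    calc PowerSeries.mk a = PowerSeries.mk a * (PowerSeries.mk (starInvC a) * PowerSeries.mk (starInvC (starInvC a))) := by
          rw [h2, mul_one]
      _ = _ := by rw [← mul_assoc, h1, one_mul]
  rw [this]; exact h2

lemma starInv_zero (n : ℕ) : starInvC (fun _ => 0) n = 0 := by
  cases n <;> simp [starInvC]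

lemma onem_eq (p : H) : PowerSeries.mk (oneMinusQPbarC p) = 1 - X * C (star p) := by
  ext n : 1
  rcases n with _ | _ | n
  · simp [oneMinusQPbarC]
  · rw [map_sub, coeff_succ_X_mul]; simp [oneMinusQPbarC, coeff_one]
  · rw [map_sub, coeff_succ_X_mul, coeff_C]; simp [oneMinusQPbarC, coeff_one]

lemma diffQuot_eq (a : ℕ → H) (ha : ∀ n, ‖a n‖ ≤ 1) (p : H) (hp : ‖p‖ < 1) :
    (X - C p) * PowerSeries.mk (diffQuotC a p) = PowerSeries.mk a - C (evalC a p) := by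
  have hs : ∀ m, Summable fun k => p^k * a (k+m) := fun m => 
    summable_of_bdd (b := fun k => a (k+m)) (fun k => ha _) hp
  have e : ∀ m, ∑' k, p^k * a (k+m) = a m + p * ∑' k, p^k * a (k+m+1) := by
    intro m
    rw [(hs m).tsum_eq_zero_add, ← tsum_mul_left]
    simp only [pow_zero, one_mul, zero_add]
    congr 2
    ext1 k
    rw [pow_succ', mul_assoc]; congr 3; ring_nf
  ext n : 1
  cases n with
  | zero =>
    rw [sub_mul, map_sub, coeff_zero_X_mul, coeff_C_mul, map_sub]
    simp only [coeff_mk, coeff_zero_C, diffQuotC, evalC]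
    have := e 0
    simp only [add_zero] at this ⊢
    rw [this]; simp
  | succ n =>
    rw [sub_mul, map_sub, coeff_succ_X_mul, coeff_C_mul, map_sub, coeff_C]
    simp only [coeff_mk, diffQuotC]
    have := e (n+1)
    simp only [← add_assoc] at this ⊢
    rw [this]; simp

lemma diffQuot_bdd (a : ℕ → H) (ha : ∀ n, ‖a n‖ ≤ 1) (p : H) (hp : ‖p‖ < 1) (n : ℕ) :
    ‖diffQuotC a p n‖ ≤ (1 - ‖p‖)⁻¹ := by
  unfold diffQuotC
  rw [← tsum_geometric_of_lt_one (norm_nonneg p) hp]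
  refine tsum_of_norm_bounded (summable_geometric_of_lt_one (norm_nonneg p) hp).hasSum ?_
  intro k
  rw [norm_mul, norm_pow]
  exact mul_le_of_le_one_right (by positivity) (ha _)

lemma one_sub_mk (a : ℕ → H) (w : H) : 
    PowerSeries.mk (fun m => (if m = 0 then (1 : H) else 0) - star w * a m) = 1 - C (star w) * PowerSeries.mk a := by
  ext n : 1
  rw [map_sub, coeff_C_mul, coeff_one]; simp

lemma one_sub_ne (x y : H) (hx : ‖x‖ < 1) (hy : ‖y‖ ≤ 1) : 1 - x * y ≠ 0 ∧ 1 - y * x ≠ 0 := by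
  have h : ‖x‖ * ‖y‖ < 1 := by nlinarith [norm_nonneg x, norm_nonneg y]
  constructor
  · intro hc
    have : ‖x * y‖ = 1 := by rw [← sub_eq_zero.1 hc]; simp
    rw [norm_mul] at this; linarith
  · intro hc
    have : ‖y * x‖ = 1 := by rw [← sub_eq_zero.1 hc]; simp
    rw [norm_mul] at this; linarith

lemma V_spec (a : ℕ → H) (ha : ∀ n, ‖a n‖ ≤ 1) (w : H) (hw : ‖w‖ < 1) :
    (1 - C (star w) * PowerSeries.mk a) * 
      PowerSeries.mk (starInvC (fun m => (if m = 0 then (1 : H) else 0) - star w * a m)) = 1 := by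
  rw [← one_sub_mk]
  apply starInv_right
  simpa using (one_sub_ne (star w) (a 0) (by simpa using hw) (ha 0)).1

lemma hdqC_schur (a : ℕ → H) (ha : Schur (PowerSeries.mk a)) (p : H) (hp : ‖p‖ < 1)
    (hw : ‖evalC a p‖ < 1) : Schur (PowerSeries.mk (hdqC a p)) := by
  have hb : ∀ n, ‖a n‖ ≤ 1 := fun n => by simpa using ha.coeff_le n
  unfold hdqC
  rw [starMul_eq, starMul_eq, onem_eq]
  exact hdq_schur ha p (evalC a p) hp hw (diffQuot_eq a hb p hp) _
    (fun n => by rw [coeff_mk]; exact diffQuot_bdd a hb p hp n) (V_spec a hb _ hw)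

lemma comm_re (s q : H) : (s + star s) * q = q * (s + star s) := by
  rw [Quaternion.self_add_star']
  exact (Quaternion.coe_commutes (2 * s.re) q)
lemma comm_nrm (s q : H) : (s * star s) * q = q * (s * star s) := by
  rw [Quaternion.self_mul_star]
  exact (Quaternion.coe_commutes _ q)

lemma bullet_eq (G V U : PowerSeries H) (w : H) (hV : (1 - C (star w) * G) * V = 1)
    (hU : U * (1 - G * C (star w)) = 1) : U * (G - C w) = (G - C w) * V := by
  have hc : C w * C (star w) * G = G * (C w * C (star w)) := by
    rw [← map_mul]
    ext n : 1
    rw [coeff_C_mul, coeff_mul_C, comm_nrm]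
  have hc2 : C w * C (star w) = C (star w) * C w := by
    rw [← map_mul, ← map_mul, Quaternion.self_mul_star, Quaternion.star_mul_self]
  have h : (1 - G * C (star w)) * (G - C w) = (G - C w) * (1 - C (star w) * G) := by
    have : (1 - G * C (star w)) * (G - C w) - (G - C w) * (1 - C (star w) * G) =
       G * (C (star w) * C w) - C w * C (star w) * G := by noncomm_ring
    rw [hc, hc2, sub_self] at this
    exact sub_eq_zero.1 this
  calc U * (G - C w) = U * (G - C w) * ((1 - C (star w) * G) * V) := by rw [hV, mul_one]
    _ = U * ((G - C w) * (1 - C (star w) * G)) * V := by simp only [mul_assoc]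
    _ = (U * (1 - G * C (star w))) * (G - C w) * V := by rw [← h]; simp only [mul_assoc]
    _ = _ := by rw [hU, one_mul]

lemma eval_lin (α β Q q' : H) (v d : ℕ → H) (hv : ∀ n, ‖v n‖ ≤ 1) (hQ : ‖Q‖ < 1)
    (h : (α + Q * β) * q' = Q * (α + Q * β)) (h0 : d 0 = α * v 0)
    (h1 : ∀ n, d (n+1) = α * v (n+1) + β * v n) (hd : Summable fun n => Q^n * d n) (hq' : ‖q'‖ < 1) :
    evalC d Q = (α + Q * β) * evalC v q' := by
  have s1 : Summable fun n => Q^n * (α * v n) := summable_of_bdd (C := ‖α‖) (fun n => by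
    rw [norm_mul]; exact mul_le_of_le_one_right (norm_nonneg _) (hv n)) hQ
  have s2 : Summable fun n => Q^n * (β * v n) := summable_of_bdd (C := ‖β‖) (fun n => by
    rw [norm_mul]; exact mul_le_of_le_one_right (norm_nonneg _) (hv n)) hQ
  have s2' : Summable fun n => Q^(n+1) * (β * v n) := by
    have := s2.mul_left Q
    simpa only [pow_succ', mul_assoc] using this
  unfold evalC
  rw [hd.tsum_eq_zero_add, ← tsum_mul_left]
  have e1 : ∀ n, Q^(n+1) * d (n+1) = Q^(n+1) * (α * v (n+1)) + Q^(n+1) * (β * v n) := fun n => by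
    rw [h1, mul_add]
  simp only [e1]
  rw [((summable_nat_add_iff 1).2 s1).tsum_add s2', h0, ← add_assoc, ← s1.tsum_eq_zero_add, ← s1.tsum_add s2']
  congr 1; ext1 n
  have := (SemiconjBy.pow_right (show SemiconjBy (α + Q * β) q' Q from h) n).eq
  rw [← mul_assoc (α + Q * β), this, pow_succ]
  noncomm_ring

lemma mobT (s q : H) (hs : ‖s‖ < 1) (hq : ‖q‖ < 1) :
    ‖mobiusT s q‖ = ‖q‖ ∧ (1 + mobiusT s q * (-star s)) * q = mobiusT s q * (1 + mobiusT s q * (-star s)) := by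
  have hα : 1 - q * s ≠ 0 := (one_sub_ne q s hq hs.le).1
  constructor
  · unfold mobiusT
    rw [norm_mul, norm_mul, norm_inv]
    have : ‖1 - q * s‖ ≠ 0 := norm_ne_zero_iff.2 hα
    field_simp
  · have hQ : (1 - q * s) * mobiusT s q = q * (1 - q * s) := by
      unfold mobiusT; rw [← mul_assoc, ← mul_assoc, mul_inv_cancel₀ hα, one_mul]
    generalize mobiusT s q = Q at *
    apply mul_left_cancel₀ hα
    have e1 : (1 - q * s) * ((1 + Q * (-star s)) * q) = (1 - q*s) * q - ((1 - q*s) * Q) * star s * q := by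
      noncomm_ring
    have e2 : (1 - q * s) * (Q * (1 + Q * (-star s))) = ((1 - q*s) * Q) - ((1 - q*s) * Q) * Q * star s := by
      noncomm_ring
    have e3 : ((1 - q*s) * Q) * Q = q * q * (1 - q*s) := by rw [hQ, mul_assoc, hQ, mul_assoc]
    rw [e1, e2, e3, hQ]
    have c1 := comm_re s q
    have c2 := comm_nrm s q
    have : ((1 - q*s) * q - (q * (1 - q*s)) * star s * q) - (q * (1 - q*s) - q * q * (1 - q*s) * star s)
      = -(q * ((s + star s) * q - q * (s + star s))) + q * q * ((s * star s) * q - q * (s * star s)) := by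
      noncomm_ring
    rw [c1, c2] at this
    simp only [sub_self, mul_zero, neg_zero, add_zero] at this
    exact sub_eq_zero.1 this

lemma schurPick (g : ℕ → H) (hg : Schur (PowerSeries.mk g)) (s : H) (hs : ‖s‖ < 1) (q : H) (hq : ‖q‖ < 1) :
    ‖evalC (bulletC (evalC g s) g) q‖ ≤ ‖mobiusEval s q‖ := by
  have hb : ∀ n, ‖g n‖ ≤ 1 := fun n => by simpa using hg.coeff_le n
  have hev := schur_eval hg s hs
  simp only [coeff_mk] at hev
  rcases hev.lt_or_eq with hw | hw
  · have hh := hdqC_schur g hg s hs hw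
    set w := evalC g s with hwd
    set h := hdqC g s with hhd
    have hV := V_spec g hb w hw
    set V := PowerSeries.mk (starInvC (fun m => (if m = 0 then (1 : H) else 0) - star w * g m)) with hVd
    have hR := diffQuot_eq g hb s hs
    rw [← hwd] at hR
    have hB : PowerSeries.mk (bulletC w g) = (PowerSeries.mk g - C w) * V := by
      unfold bulletC
      rw [starMul_eq]
      have e1 : PowerSeries.mk (fun m => g m - if m = 0 then w else 0) = PowerSeries.mk g - C w := by
        ext n : 1
        rw [map_sub, coeff_C]; simp
      have e2 : PowerSeries.mk (fun m => (if m = 0 then (1:H) else 0) - g m * star w) = 1 - PowerSeries.mk g * C (star w) := by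
        ext n : 1
        rw [map_sub, coeff_mul_C, coeff_one]; simp
      rw [e1]
      apply bullet_eq _ _ _ _ hV
      rw [← e2]
      apply starInv_left
      simpa using (one_sub_ne (star w) (g 0) (by simpa using hw) (hb 0)).2
    have hBs : Schur (PowerSeries.mk (bulletC w g)) := by
      intro k N
      rw [hB, mul_assoc]
      refine (bullet_nr hg w hw.le (V*k) N).trans ?_
      rw [← mul_assoc, hV, one_mul]
    have hBb : ∀ n, ‖bulletC w g n‖ ≤ 1 := fun n => by simpa using hBs.coeff_le n
    have hhb : ∀ n, ‖h n‖ ≤ 1 := fun n => by simpa using hh.coeff_le n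
    have hD : (1 - X * C (star s)) * PowerSeries.mk (bulletC w g) = (X - C s) * PowerSeries.mk h := by
      rw [hB, ← hR, hhd, hdqC, starMul_eq, starMul_eq, onem_eq, ← hVd]
      have hc : (1 - X * C (star s)) * (X - C s) = (X - C s) * (1 - X * C (star s)) := by
        have x1 : C (star s) * X = X * C (star s) := (X_mul (φ := C (star s))).symm
        have x2 : C s * X = X * C s := (X_mul (φ := C s)).symm
        have hc2 : C s * C (star s) = C (star s) * C s := by
          rw [← map_mul, ← map_mul, Quaternion.self_mul_star, Quaternion.star_mul_self]
        have : (1 - X * C (star s)) * (X - C s) - (X - C s) * (1 - X * C (star s)) =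
          X * (X * C (star s)) - X * (C (star s) * X) + X * (C (star s) * C s) - (C s * X) * C (star s) := by
          noncomm_ring
        rw [x1, x2, mul_assoc X (C s), hc2] at this
        simp only [sub_self, zero_add] at this
        exact sub_eq_zero.1 this
      simp only [← mul_assoc]
      rw [hc]
    obtain ⟨hQn, hQc⟩ := mobT s q hs hq
    set Q := mobiusT s q with hQd
    have hQ1 : ‖Q‖ < 1 := by rw [hQn]; exact hq
    set d : ℕ → H := fun n => coeff n ((X - C s) * PowerSeries.mk h) with hdd
    have d0 : d 0 = -s * h 0 := by
      simp only [hdd]; rw [sub_mul, map_sub, coeff_zero_X_mul, coeff_C_mul, coeff_mk]; simp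
    have d1 : ∀ n, d (n+1) = -s * h (n+1) + 1 * h n := by
      intro n
      simp only [hdd]; rw [sub_mul, map_sub, coeff_succ_X_mul, coeff_C_mul, coeff_mk, coeff_mk]
      noncomm_ring
    have d0' : d 0 = 1 * bulletC w g 0 := by
      simp only [hdd]; rw [← hD, sub_mul, map_sub, mul_assoc, coeff_zero_X_mul, one_mul, coeff_mk]; simp
    have d1' : ∀ n, d (n+1) = 1 * bulletC w g (n+1) + -star s * bulletC w g n := by
      intro n
      simp only [hdd]; rw [← hD, sub_mul, map_sub, mul_assoc, coeff_succ_X_mul, coeff_C_mul, one_mul, coeff_mk, coeff_mk]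
      noncomm_ring
    have hdb : ∀ n, ‖d n‖ ≤ 2 := by
      intro n
      cases n with
      | zero => rw [d0', one_mul]; linarith [hBb 0]
      | succ n =>
        rw [d1', one_mul]
        refine (norm_add_le _ _).trans ?_
        rw [norm_mul, norm_neg, norm_star]
        nlinarith [hBb n, hBb (n+1), norm_nonneg s, norm_nonneg (bulletC w g n)]
    have hds := summable_of_bdd hdb hQ1
    have E1 := eval_lin 1 (-star s) Q q (bulletC w g) d hBb hQ1 hQc d0' d1' hds hq
    have hu : 1 + Q * (-star s) ≠ 0 := by
      have := (one_sub_ne Q (star s) hQ1 (by simpa using hs.le)).1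
      rwa [mul_neg, ← sub_eq_add_neg]
    obtain ⟨q', hq', hq'c⟩ : ∃ q' : H, ‖q'‖ < 1 ∧ (-s + Q * 1) * q' = Q * (-s + Q * 1) := by
      by_cases hz : -s + Q * 1 = 0
      · exact ⟨0, by simp, by rw [hz]; simp⟩
      · refine ⟨(-s + Q*1)⁻¹ * Q * (-s + Q*1), ?_, ?_⟩
        · rw [norm_mul, norm_mul, norm_inv]
          have : ‖-s + Q*1‖ ≠ 0 := norm_ne_zero_iff.2 hz
          have e : ‖-s + Q*1‖⁻¹ * ‖Q‖ * ‖-s + Q*1‖ = ‖Q‖ := by field_simp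
          rw [e]; exact hQ1
        · rw [← mul_assoc, ← mul_assoc, mul_inv_cancel₀ hz, one_mul]
    have E2 := eval_lin (-s) 1 Q q' h d hhb hQ1 hq'c d0 d1 hds hq'
    have hh1 := schur_eval hh q' hq'
    simp only [coeff_mk] at hh1
    rw [E1] at E2
    have hn := congrArg norm E2
    rw [norm_mul, norm_mul] at hn
    have hun : 0 < ‖1 + Q * (-star s)‖ := norm_pos_iff.2 hu
    have hfin : mobiusEval s q = (1 + Q * (-star s))⁻¹ * (-s + Q * 1) := by
      unfold mobiusEval mobiusM
      rw [← hQd, mul_neg, ← sub_eq_add_neg, mul_one, neg_add_eq_sub]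
    rw [hfin, norm_mul, norm_inv, ← div_eq_inv_mul, le_div_iff₀ hun, mul_comm, hn]
    exact mul_le_of_le_one_right (norm_nonneg _) hh1
  · have hc := schur_const hg s hs (evalC g s) (by simp only [coeff_mk]) hw
    simp only [coeff_mk] at hc
    have : bulletC (evalC g s) g = fun _ => 0 := by
      unfold bulletC
      have e : (fun m => (if m = 0 then (1:H) else 0) - g m * star (evalC g s)) = fun _ => 0 := by
        ext1 m; rw [hc, sub_self]
      rw [e]
      ext1 n
      simp [starMulC, starInv_zero]
    rw [this]
    simp [evalC]

/-- Three-points Schwarz–Pick Lemma: if `f` is a slice regular self-map of `𝔹`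
which is not a regular Möbius transformation times a unimodular constant, then
`|(ℳ_{f⋆_p(s)} ∙ f⋆_p)(q)| ≤ |ℳ_s(q)|` for all `q ∈ 𝔹`. -/
theorem threePoints_schwarzPick (a : ℕ → H) (ha : SelfMap a)
    (hnot : ¬ IsBlaschke a 1) (p s : H) (hp : ‖p‖ < 1) (hs : ‖s‖ < 1) :
    ∀ q : H, ‖q‖ < 1 →
      ‖evalC (bulletC (evalC (hdqC a p) s) (hdqC a p)) q‖ ≤ ‖mobiusEval s q‖ := by
  intro q hq
  exact schurPick _ (hdqC_schur a (bounded_schur a ha.1 fun q hq => (ha.2 q hq).le) p hp (ha.2 p hp)) s hs q hq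


end QPaper
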